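/- Let η ≥ 0, assume L/μ ≥ 4 and λ_N^W > 0, and let 0 < α ≤ α̂ where α̂ := min{λ_N^W/L, μ³/(60η²)²} if η > 0 and α̂ := λ_N^W/L if η = 0, with momentum β = (1−√(αμ))/(1+√(αμ)). Suppose the D-ASG noise satisfies, almost surely, E[w^{(k+1)} | ℱ_k] = 0 and E[‖w^{(k+1)}‖² | ℱ_k] ≤ σ²N + (η²/2)‖y^{(k)} − x^*‖², and that ‖x^∞ − x^*‖ ≤ αC₁√N/(1−γ). Define Q̃_α := vvᵀ + 2αη²·uuᵀ with v := (√(1/(2α)), √(μ/2) − √(1/(2α)))ᵀ and u := (1+β, −β)ᵀ, Q_α := Q̃_α ⊗ I_{Nd}, T := [1 0] ⊗ I_{Nd}, and V_{Q,α}(ξ) := ξᵀQ_αξ + F_{W,α}(Tξ + x^∞) − F_{W,α}(x^∞). Then for every k ≥ 0, E[‖x^{(k)} − x^∞‖²] ≤ 2(1 − √(αμ)/3)^k·V_{Q,α}(ξ₀)/μ + (12√α/(μ√μ))·(σ² + η²α²C₁²/(1−γ)²)·N. -/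

import Mathlib

open MeasureTheory Filter Real ProbabilityTheory
open scoped RealInnerProductSpace ENNReal NNReal Matrix

/-- The penalized objective `F_{W,α}(x) = (1/(2α)) xᵀ(I−𝒲)x + F(x)`. -/
noncomputable def penObj {N d : ℕ} (W : Matrix (Fin N) (Fin N) ℝ) (α : ℝ)
    (f : Fin N → EuclideanSpace ℝ (Fin d) → ℝ)
    (x : PiLp 2 (fun _ : Fin N => EuclideanSpace ℝ (Fin d))) : ℝ :=
  1 / (2 * α) * ((∑ i, ‖x i‖ ^ 2) - ∑ i, ∑ j, W i j * ⟪x i, x j⟫) + ∑ i, f i (x i)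

/-- The Lyapunov function `V_{Q,α}(ξ) = ξᵀQ_αξ + F_{W,α}(Tξ+x^∞) − F_{W,α}(x^∞)` with
`Q_α = (vvᵀ + 2αη² uuᵀ) ⊗ I_{Nd}`, `v = (√(1/(2α)), √(μ/2) − √(1/(2α)))ᵀ`,
`u = (1+β, −β)ᵀ`, written for `ξ = (a, b) ∈ ℝ^{Nd} × ℝ^{Nd}`
(so that `ξᵀQ_αξ = ‖v₁a + v₂b‖² + 2αη²‖(1+β)a − βb‖²`). -/
noncomputable def lyapQ {N d : ℕ} (W : Matrix (Fin N) (Fin N) ℝ) (α μ β η : ℝ)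
    (f : Fin N → EuclideanSpace ℝ (Fin d) → ℝ)
    (xinf a b : PiLp 2 (fun _ : Fin N => EuclideanSpace ℝ (Fin d))) : ℝ :=
  ‖Real.sqrt (1 / (2 * α)) • a + (Real.sqrt (μ / 2) - Real.sqrt (1 / (2 * α))) • b‖ ^ 2 +
    2 * α * η ^ 2 * ‖(1 + β) • a - β • b‖ ^ 2 +
    penObj W α f (a + xinf) - penObj W α f xinf

/-- Descent lemma for a function with Lipschitz gradient. -/
lemma le_add_inner_gradient_of_lipschitz {E : Type*} [NormedAddCommGroup E]
    [InnerProductSpace ℝ E] [CompleteSpace E] {f : E → ℝ} {g : E → E} {L : ℝ}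
    (hg : ∀ x, HasGradientAt f (g x) x) (hL : ∀ x y, ‖g x - g y‖ ≤ L * ‖x - y‖) (x y : E) :
    f x ≤ f y + ⟪g y, x - y⟫ + L / 2 * ‖x - y‖ ^ 2 := by
  set δ := x - y with hδ
  have hline : ∀ t : ℝ, HasDerivAt (fun t : ℝ => y + t • δ) δ t := fun t => by
    simpa using ((hasDerivAt_id t).smul_const δ).const_add y
  have hd : ∀ t : ℝ, HasDerivAt
      (fun t : ℝ => f (y + t • δ) - t * ⟪g y, δ⟫ - L / 2 * ‖δ‖ ^ 2 * t ^ 2)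
      (⟪g (y + t • δ), δ⟫ - ⟪g y, δ⟫ - L / 2 * ‖δ‖ ^ 2 * (2 * t)) t := fun t => by
    have h1 : HasDerivAt (fun t : ℝ => f (y + t • δ)) ⟪g (y + t • δ), δ⟫ t :=
      ((hg (y + t • δ)).hasFDerivAt.comp_hasDerivAt t (hline t)).congr_deriv (by simp)
    have h2 := (hasDerivAt_id t).mul_const ⟪g y, δ⟫
    have h3 := ((hasDerivAt_id t).pow 2).const_mul (L / 2 * ‖δ‖ ^ 2)
    exact ((h1.sub h2).sub h3).congr_deriv (by simp)
  have hanti : AntitoneOn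
      (fun t : ℝ => f (y + t • δ) - t * ⟪g y, δ⟫ - L / 2 * ‖δ‖ ^ 2 * t ^ 2) (Set.Icc 0 1) := by
    refine antitoneOn_of_deriv_nonpos (convex_Icc 0 1)
      (fun t _ => (hd t).continuousAt.continuousWithinAt)
      (fun t _ => (hd t).differentiableAt.differentiableWithinAt) fun t ht => ?_
    rw [interior_Icc] at ht
    rw [(hd t).deriv, ← inner_sub_left]
    have h1 := real_inner_le_norm (g (y + t • δ) - g y) δ
    have h2 := hL (y + t • δ) y
    rw [add_sub_cancel_left, norm_smul, Real.norm_eq_abs, abs_of_pos ht.1] at h2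
    nlinarith [norm_nonneg δ, mul_le_mul_of_nonneg_right h2 (norm_nonneg δ)]
  have h := hanti (Set.left_mem_Icc.2 zero_le_one) (Set.right_mem_Icc.2 zero_le_one) zero_le_one
  simp only [one_smul, zero_smul, add_zero, hδ, add_sub_cancel] at h
  simp only [hδ]
  linarith

/-- First-order characterization of strong convexity. -/
lemma add_inner_gradient_le_of_strongConvex {E : Type*} [NormedAddCommGroup E]
    [InnerProductSpace ℝ E] [CompleteSpace E] {f : E → ℝ} {g : E → E} {μ : ℝ}
    (hg : ∀ x, HasGradientAt f (g x) x)
    (hf : ConvexOn ℝ Set.univ (fun x => f x - μ / 2 * ‖x‖ ^ 2)) (x y : E) :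
    f y + ⟪g y, x - y⟫ + μ / 2 * ‖x - y‖ ^ 2 ≤ f x := by
  set δ := x - y with hδ
  have hline : HasDerivAt (fun t : ℝ => y + t • δ) δ 0 := by
    simpa using ((hasDerivAt_id (0 : ℝ)).smul_const δ).const_add y
  have h1 : HasDerivAt (fun t : ℝ => f (y + t • δ)) ⟪g y, δ⟫ 0 := by
    have h : HasGradientAt f (g y) (y + (0 : ℝ) • δ) := by simpa using hg y
    exact (h.hasFDerivAt.comp_hasDerivAt 0 hline).congr_deriv (by simp)
  have hd : HasDerivAt (fun t : ℝ => f (y + t • δ) - μ / 2 * ‖y + t • δ‖ ^ 2)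
      (⟪g y, δ⟫ - μ / 2 * (2 * ⟪y, δ⟫)) 0 :=
    (h1.sub (hline.norm_sq.const_mul (μ / 2))).congr_deriv (by simp)
  have hc : ConvexOn ℝ Set.univ (fun t : ℝ => f (y + t • δ) - μ / 2 * ‖y + t • δ‖ ^ 2) := by
    have := hf.comp_affineMap (AffineMap.lineMap y x)
    simpa [Function.comp_def, AffineMap.lineMap_apply, hδ, add_comm] using this
  have h := hc.le_slope_of_hasDerivAt (Set.mem_univ 0) (Set.mem_univ 1) zero_lt_one hd
  rw [slope_def_field] at h
  have hx : y + δ = x := by simp [hδ]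
  have hn := norm_add_sq_real y δ
  simp only [one_smul, zero_smul, add_zero, hx, sub_zero, div_one] at h
  rw [hx] at hn
  rw [hn] at h
  linarith

/-- The Lyapunov function of the accelerated gradient method with stepsize `α`, where `s` stands
for `√(αμ)`, centered at the minimizer `p`. -/
noncomputable def accelLyap {E : Type*} [NormedAddCommGroup E] [InnerProductSpace ℝ E]
    (H : E → ℝ) (p : E) (α s : ℝ) (x b : E) : ℝ :=
  1 / (2 * α) * ‖(x - p) - (1 - s) • (b - p)‖ ^ 2 + (H x - H p)

section Deterministic

variable {E : Type*} [NormedAddCommGroup E] [InnerProductSpace ℝ E] {H : E → ℝ} {G : E → E}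
  {p : E} {α μ s β : ℝ}

/-- One step of the inexact accelerated gradient method contracts `accelLyap` by `1 - s`, up to
the noise terms. -/
lemma accelLyap_step (hα : 0 < α) (hs0 : 0 < s) (hs1 : s ≤ 1) (hs : s ^ 2 = α * μ)
    (hβ : β = (1 - s) / (1 + s))
    (hsm : ∀ x y, H x ≤ H y + ⟪G y, x - y⟫ + 1 / (2 * α) * ‖x - y‖ ^ 2)
    (hsc : ∀ x y, H y + ⟪G y, x - y⟫ + μ / 2 * ‖x - y‖ ^ 2 ≤ H x)
    {x b y w x' : E} (hy : y = (1 + β) • x - β • b) (hx' : x' = y - α • G y - α • w) :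
    accelLyap H p α s x' x ≤ (1 - s) * accelLyap H p α s x b + α * ‖w‖ ^ 2
      - ⟪(y - p) - α • G y - (1 - s) • (x - p), w⟫ := by
  have hs' : (1 + s) ≠ 0 := by positivity
  have h1 := hsm x' y
  have h2 := mul_le_mul_of_nonneg_left (hsc p y) hs0.le
  have h3 := mul_le_mul_of_nonneg_left (hsc x y) (sub_nonneg.2 hs1)
  obtain ⟨A, rfl⟩ : ∃ A, x = A + p := ⟨x - p, by simp⟩
  obtain ⟨B, rfl⟩ : ∃ B, b = B + p := ⟨b - p, by simp⟩
  obtain ⟨Y, rfl⟩ : ∃ Y, y = Y + p := ⟨y - p, by simp⟩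
  have hB : A - (1 - s) • B = (1 + s) • Y - A := by
    have : Y = (1 + β) • A - β • B := by
      have : Y + p = ((1 + β) • A - β • B) + p := by rw [hy]; module
      exact add_right_cancel this
    rw [this, hβ]
    match_scalars <;> (field_simp; try ring)
  set g := G (Y + p)
  have e1 : x' - (Y + p) = -(α • g) - α • w := by rw [hx']; module
  have e2 : x' - p = Y - α • g - α • w := by rw [hx']; module
  have e3 : p - (Y + p) = -Y := by module
  have e4 : A + p - (Y + p) = A - Y := by module
  rw [e1] at h1
  rw [e3] at h2
  rw [e4] at h3
  have hgap : 0 ≤ 1 / (2 * α) * (s * (1 - s ^ 2) * ‖Y - A‖ ^ 2) := by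
    have : 0 ≤ 1 - s ^ 2 := by nlinarith
    positivity
  obtain ⟨c, hc⟩ : ∃ c, c = 1 / (2 * α) := ⟨_, rfl⟩
  have hcα : c * α = 1 / 2 := by rw [hc]; field_simp
  have hμ : μ = 2 * c * s ^ 2 := by rw [hs]; linear_combination (-2 * μ) * hcα
  simp only [accelLyap, add_sub_cancel_right, e2, hB]
  rw [← hc] at h1 hgap ⊢
  subst hμ
  simp only [← real_inner_self_eq_norm_sq, inner_sub_left, inner_sub_right,
    inner_neg_left, inner_neg_right, inner_smul_left, inner_smul_right,
    conj_trivial, real_inner_comm Y A, real_inner_comm A g, real_inner_comm Y g,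
    real_inner_comm Y w, real_inner_comm A w, real_inner_comm g w] at h1 h2 h3 hgap ⊢
  linear_combination h1 + h2 + h3 + hgap + (2 * α * (⟪g, g⟫ + 2 * ⟪g, w⟫ + ⟪w, w⟫)
    - 2 * (⟪Y, g⟫ + ⟪Y, w⟫ - (1 - s) * (⟪A, g⟫ + ⟪A, w⟫))) * hcα

lemma norm_sq_extrapolation_le (hμ : 0 < μ) (hα : 0 < α) (hs0 : 0 < s) (hs : s ^ 2 = α * μ)
    (hβ : β = (1 - s) / (1 + s)) (hH : ∀ x, μ / 2 * ‖x - p‖ ^ 2 ≤ H x - H p) (x b : E) :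
    ‖((1 + β) • x - β • b) - p‖ ^ 2 ≤ 2 / μ * accelLyap H p α s x b := by
  have hs' : (1 + s) ≠ 0 := by positivity
  have hμs : 1 / (2 * α) = μ / (2 * s ^ 2) := by rw [hs]; field_simp
  set a := x - p with ha
  set r := a - (1 - s) • (b - p) with hr
  have he : (1 + β) • x - β • b - p = (1 / (1 + s)) • (a + r) := by
    rw [hr, ha, hβ]
    match_scalars <;> (field_simp; try ring)
  have h1 : ‖a + r‖ ^ 2 ≤ (1 + s ^ 2) * (‖a‖ ^ 2 + ‖r‖ ^ 2 / s ^ 2) := by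
    have h2 : 0 ≤ (s * ‖a‖ - ‖r‖ / s) ^ 2 := sq_nonneg _
    have h3 : (s * ‖a‖ - ‖r‖ / s) ^ 2
        = s ^ 2 * ‖a‖ ^ 2 - 2 * (‖a‖ * ‖r‖) + ‖r‖ ^ 2 / s ^ 2 := by
      field_simp
      ring
    have h4 : s ^ 2 * (‖r‖ ^ 2 / s ^ 2) = ‖r‖ ^ 2 := by field_simp
    rw [norm_add_sq_real]
    nlinarith [real_inner_le_norm a r]
  have h2 : ‖a‖ ^ 2 + ‖r‖ ^ 2 / s ^ 2 ≤ 2 / μ * accelLyap H p α s x b := by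
    have h3 := mul_le_mul_of_nonneg_left (hH x) (by positivity : 0 ≤ 2 / μ)
    have h4 : 2 / μ * (μ / 2 * ‖a‖ ^ 2) = ‖a‖ ^ 2 := by field_simp
    have h5 : 2 / μ * (μ / (2 * s ^ 2) * ‖r‖ ^ 2) = ‖r‖ ^ 2 / s ^ 2 := by field_simp
    rw [accelLyap, ← ha, ← hr, hμs, mul_add, h5]
    linarith
  rw [he, norm_smul, mul_pow, Real.norm_eq_abs, sq_abs]
  have h0 : 0 ≤ ‖a‖ ^ 2 + ‖r‖ ^ 2 / s ^ 2 := by positivity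
  have h3 : (1 / (1 + s)) ^ 2 * (1 + s ^ 2) ≤ 1 := by
    rw [div_pow, one_pow, one_div_mul_eq_div, div_le_one (by positivity)]
    nlinarith
  calc (1 / (1 + s)) ^ 2 * ‖a + r‖ ^ 2
      ≤ (1 / (1 + s)) ^ 2 * ((1 + s ^ 2) * (‖a‖ ^ 2 + ‖r‖ ^ 2 / s ^ 2)) := by gcongr
    _ = ((1 / (1 + s)) ^ 2 * (1 + s ^ 2)) * (‖a‖ ^ 2 + ‖r‖ ^ 2 / s ^ 2) := by ring
    _ ≤ 1 * (‖a‖ ^ 2 + ‖r‖ ^ 2 / s ^ 2) := by gcongr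
    _ ≤ _ := by rwa [one_mul]

/-- The gradient of a smooth function minimized at `p` grows at most linearly away from `p`. -/
lemma norm_gradient_le (hα : 0 < α) (hH0 : ∀ x, 0 ≤ H x - H p)
    (hH1 : ∀ x, H x - H p ≤ 1 / (2 * α) * ‖x - p‖ ^ 2)
    (hsm : ∀ x y, H x ≤ H y + ⟪G y, x - y⟫ + 1 / (2 * α) * ‖x - y‖ ^ 2) (y : E) :
    ‖G y‖ ≤ 1 / α * ‖y - p‖ := by
  have h1 := hsm (y - α • G y) y
  have h2 := hH0 (y - α • G y)
  have h3 := hH1 y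
  rw [sub_sub_cancel_left, inner_neg_right, inner_smul_right, real_inner_self_eq_norm_sq, norm_neg,
    norm_smul, Real.norm_eq_abs, abs_of_pos hα] at h1
  have h4 : 1 / (2 * α) * (α * ‖G y‖) ^ 2 = α / 2 * ‖G y‖ ^ 2 := by field_simp
  have h5 : α / 2 * ‖G y‖ ^ 2 ≤ 1 / (2 * α) * ‖y - p‖ ^ 2 := by linarith
  have h6 : 1 / (2 * α) * ‖y - p‖ ^ 2 = α / 2 * (1 / α * ‖y - p‖) ^ 2 := by field_simp
  rw [h6] at h5
  exact le_of_sq_le_sq (le_of_mul_le_mul_left h5 (by positivity)) (by positivity)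

end Deterministic

lemma integrable_inner_of_memLp_two {E Ω : Type*} [NormedAddCommGroup E] [InnerProductSpace ℝ E]
    {mΩ : MeasurableSpace Ω} {P : Measure Ω} {u w : Ω → E} (hu : MemLp u 2 P) (hw : MemLp w 2 P) :
    Integrable (fun ω => ⟪u ω, w ω⟫) P :=
  memLp_one_iff_integrable.1 ((innerSL ℝ (E := E)).memLp_of_bilin 1 hu hw)

section Stochastic

variable {E : Type*} [NormedAddCommGroup E] [InnerProductSpace ℝ E] {H : E → ℝ} {G : E → E}
  {p : E} {α μ s β : ℝ}
  {Ω : Type*} {m mΩ : MeasurableSpace Ω} {P : Measure Ω} [IsProbabilityMeasure P]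

/-- A square-integrable `m`-measurable vector is orthogonal in mean to a square-integrable vector
whose conditional expectation given `m` vanishes. -/
lemma integral_inner_eq_zero_of_condExp_eq_zero [CompleteSpace E] (hm : m ≤ mΩ) {u w : Ω → E}
    (hum : StronglyMeasurable[m] u) (hu : MemLp u 2 P) (hw : MemLp w 2 P)
    (hw0 : P[w|m] =ᵐ[P] 0) : ∫ ω, ⟪u ω, w ω⟫ ∂P = 0 := by
  have hint : Integrable (fun ω => ⟪u ω, w ω⟫) P := integrable_inner_of_memLp_two hu hw
  have h := condExp_bilin_of_stronglyMeasurable_left (innerSL ℝ (E := E)) hum hint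
    (hw.integrable one_le_two)
  rw [← integral_condExp hm]
  refine integral_eq_zero_of_ae ?_
  filter_upwards [h, hw0] with ω h1 h2
  refine h1.trans ?_
  simp [h2]

lemma integrable_accelLyap (hHc : Continuous H)
    (hH0 : ∀ x, 0 ≤ H x - H p) (hH1 : ∀ x, H x - H p ≤ 1 / (2 * α) * ‖x - p‖ ^ 2)
    {x b : Ω → E} (hx : MemLp x 2 P) (hb : MemLp b 2 P) :
    Integrable (fun ω => accelLyap H p α s (x ω) (b ω)) P := by
  have hxp : MemLp (fun ω => x ω - p) 2 P := hx.sub (memLp_const p)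
  have hbp : MemLp (fun ω => b ω - p) 2 P := hb.sub (memLp_const p)
  refine ((hxp.sub (hbp.const_smul (1 - s))).integrable_norm_pow two_ne_zero).const_mul _ |>.add ?_
  refine ((hxp.integrable_norm_pow two_ne_zero).const_mul (1 / (2 * α))).mono' ?_ ?_
  · exact (hHc.comp_aestronglyMeasurable hx.1).sub aestronglyMeasurable_const
  · refine ae_of_all _ fun ω => ?_
    rw [Real.norm_eq_abs, abs_of_nonneg (hH0 _)]
    exact hH1 _

/-- One step of the accelerated stochastic gradient method, in expectation. -/
lemma integral_accelLyap_step [CompleteSpace E] (hm : m ≤ mΩ)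
    (hα : 0 < α) (hμ : 0 < μ) (hs0 : 0 < s) (hs1 : s ≤ 1) (hs : s ^ 2 = α * μ)
    (hβ : β = (1 - s) / (1 + s)) (hHc : Continuous H) (hG : Continuous G)
    (hp : G p = 0)
    (hsm : ∀ x y, H x ≤ H y + ⟪G y, x - y⟫ + 1 / (2 * α) * ‖x - y‖ ^ 2)
    (hsc : ∀ x y, H y + ⟪G y, x - y⟫ + μ / 2 * ‖x - y‖ ^ 2 ≤ H x)
    {x b y w x' : Ω → E} (hxm : StronglyMeasurable[m] x) (hbm : StronglyMeasurable[m] b)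
    (hx : MemLp x 2 P) (hb : MemLp b 2 P) (hw : MemLp w 2 P)
    (hy : ∀ ω, y ω = (1 + β) • x ω - β • b ω)
    (hx' : ∀ ω, x' ω = y ω - α • G (y ω) - α • w ω)
    (hw0 : P[w|m] =ᵐ[P] 0) {κ ν Δ : ℝ} {q : E} (hq : ‖p - q‖ ≤ Δ)
    (hwvar : ∀ᵐ ω ∂P, (P[fun ω' => ‖w ω'‖ ^ 2|m]) ω ≤ κ + ν ^ 2 / 2 * ‖y ω - q‖ ^ 2) :
    MemLp y 2 P ∧ MemLp x' 2 P ∧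
      ∫ ω, accelLyap H p α s (x' ω) (x ω) ∂P ≤ (1 - s) * ∫ ω, accelLyap H p α s (x ω) (b ω) ∂P
        + α * (κ + ν ^ 2 * Δ ^ 2) + α * ν ^ 2 * ∫ ω, ‖y ω - p‖ ^ 2 ∂P := by
  have hH0 : ∀ x, 0 ≤ H x - H p := fun x => by
    have := hsc x p
    rw [hp, inner_zero_left] at this
    nlinarith [sq_nonneg ‖x - p‖]
  have hH1 : ∀ x, H x - H p ≤ 1 / (2 * α) * ‖x - p‖ ^ 2 := fun x => by
    have := hsm x p
    rw [hp, inner_zero_left] at this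
    linarith
  have hyfun : y = fun ω => (1 + β) • x ω - β • b ω := funext hy
  have hym : StronglyMeasurable[m] y := by
    rw [hyfun]; exact (hxm.const_smul _).sub (hbm.const_smul _)
  have hyL : MemLp y 2 P := by
    rw [hyfun]; exact (hx.const_smul _).sub (hb.const_smul _)
  have hGy : MemLp (fun ω => G (y ω)) 2 P := by
    refine (hyL.sub (memLp_const p)).of_le_mul (c := 1 / α)
      (hG.comp_aestronglyMeasurable hyL.1) (ae_of_all _ fun ω => ?_)
    exact norm_gradient_le hα hH0 hH1 hsm _
  have hGym : StronglyMeasurable[m] (fun ω => G (y ω)) := hG.comp_stronglyMeasurable hym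
  have hx'L : MemLp x' 2 P := by
    rw [funext hx']
    exact (hyL.sub (hGy.const_smul α)).sub (hw.const_smul α)
  refine ⟨hyL, hx'L, ?_⟩
  set u : Ω → E := fun ω => (y ω - p) - α • G (y ω) - (1 - s) • (x ω - p) with hu
  have hum : StronglyMeasurable[m] u :=
    ((hym.sub stronglyMeasurable_const).sub (hGym.const_smul α)).sub
      ((hxm.sub stronglyMeasurable_const).const_smul (1 - s))
  have huL : MemLp u 2 P :=
    ((hyL.sub (memLp_const p)).sub (hGy.const_smul α)).sub
      ((hx.sub (memLp_const p)).const_smul (1 - s))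
  have hw2 : Integrable (fun ω => ‖w ω‖ ^ 2) P := hw.integrable_norm_pow two_ne_zero
  have hV := integrable_accelLyap (s := s) hHc hH0 hH1 hx hb
  have hV' := integrable_accelLyap (s := s) hHc hH0 hH1 hx'L hx
  have hypL : Integrable (fun ω => ‖y ω - p‖ ^ 2) P :=
    (hyL.sub (memLp_const p)).integrable_norm_pow two_ne_zero
  have huw : Integrable (fun ω => ⟪u ω, w ω⟫) P := integrable_inner_of_memLp_two huL hw
  have hsum : Integrable
      (fun ω => (1 - s) * accelLyap H p α s (x ω) (b ω) + α * ‖w ω‖ ^ 2) P :=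
    (hV.const_mul _).add (hw2.const_mul _)
  have h1 : ∫ ω, accelLyap H p α s (x' ω) (x ω) ∂P ≤
      ∫ ω, ((1 - s) * accelLyap H p α s (x ω) (b ω) + α * ‖w ω‖ ^ 2 - ⟪u ω, w ω⟫) ∂P :=
    integral_mono hV' (hsum.sub huw) fun ω =>
      accelLyap_step hα hs0 hs1 hs hβ hsm hsc (hy ω) (hx' ω)
  rw [integral_sub hsum huw, integral_add (hV.const_mul _) (hw2.const_mul _), integral_const_mul, integral_const_mul,
    integral_inner_eq_zero_of_condExp_eq_zero hm hum huL hw hw0] at h1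
  have h2 : ∫ ω, ‖w ω‖ ^ 2 ∂P ≤ ∫ ω, (κ + ν ^ 2 * Δ ^ 2 + ν ^ 2 * ‖y ω - p‖ ^ 2) ∂P := by
    rw [← integral_condExp hm]
    refine integral_mono_ae integrable_condExp
      ((integrable_const _).add (hypL.const_mul _)) ?_
    filter_upwards [hwvar] with ω hω
    refine hω.trans ?_
    have h3 : ‖y ω - q‖ ≤ ‖y ω - p‖ + Δ := by
      have : y ω - q = (y ω - p) + (p - q) := by abel
      rw [this]
      exact (norm_add_le _ _).trans (by gcongr)
    have h4 : ‖y ω - q‖ ^ 2 ≤ 2 * ‖y ω - p‖ ^ 2 + 2 * Δ ^ 2 :=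
      (pow_le_pow_left₀ (norm_nonneg _) h3 2).trans
        (by nlinarith [sq_nonneg (‖y ω - p‖ - Δ)])
    nlinarith [mul_le_mul_of_nonneg_left h4 (sq_nonneg ν)]
  rw [integral_add (integrable_const _) (hypL.const_mul _), integral_const_mul,
    integral_const, probReal_univ, one_smul] at h2
  nlinarith [mul_le_mul_of_nonneg_left h2 hα.le]

/-- Convergence of the accelerated stochastic gradient method under state-dependent noise, measured
by `accelLyap` augmented with a multiple of the squared distance of the extrapolated point. -/
theorem integral_accelLyap_le [CompleteSpace E]
    (hα : 0 < α) (hμ : 0 < μ) (hs0 : 0 < s) (hs1 : s ≤ 1 / 2) (hs : s ^ 2 = α * μ)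
    (hβ : β = (1 - s) / (1 + s)) (hHc : Continuous H) (hG : Continuous G)
    (hp : G p = 0)
    (hsm : ∀ x y, H x ≤ H y + ⟪G y, x - y⟫ + 1 / (2 * α) * ‖x - y‖ ^ 2)
    (hsc : ∀ x y, H y + ⟪G y, x - y⟫ + μ / 2 * ‖x - y‖ ^ 2 ≤ H x)
    {ℱ : ℕ → MeasurableSpace Ω} (hℱ : ∀ k, ℱ k ≤ mΩ)
    {x b y w : ℕ → Ω → E} {x0 b0 : E} (hx0 : ∀ ω, x 0 ω = x0) (hb0 : ∀ ω, b 0 ω = b0)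
    (hb : ∀ k, b (k + 1) = x k)
    (hxm : ∀ k, StronglyMeasurable[ℱ k] (x k)) (hbm : ∀ k, StronglyMeasurable[ℱ k] (b k))
    (hw : ∀ k, MemLp (w (k + 1)) 2 P)
    (hy : ∀ k ω, y k ω = (1 + β) • x k ω - β • b k ω)
    (hx : ∀ k ω, x (k + 1) ω = y k ω - α • G (y k ω) - α • w (k + 1) ω)
    (hw0 : ∀ k, P[w (k + 1)|ℱ k] =ᵐ[P] 0) {κ ν Δ : ℝ} (hκ : 0 ≤ κ) {q : E} (hq : ‖p - q‖ ≤ Δ)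
    (hν : 60 * α * ν ^ 2 ≤ s * μ)
    (hwvar : ∀ k, ∀ᵐ ω ∂P, (P[fun ω' => ‖w (k + 1) ω'‖ ^ 2|ℱ k]) ω ≤
      κ + ν ^ 2 / 2 * ‖y k ω - q‖ ^ 2) (k : ℕ) :
    ∫ ω, ‖x k ω - p‖ ^ 2 ∂P ≤
      2 / μ * ((1 - s / 3) ^ k * (accelLyap H p α s x0 b0
        + 2 * α * ν ^ 2 * ‖((1 + β) • x0 - β • b0) - p‖ ^ 2)
        + 31 / 10 * (α / s) * (κ + ν ^ 2 * Δ ^ 2)) := by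
  have hgrow : ∀ x, μ / 2 * ‖x - p‖ ^ 2 ≤ H x - H p := fun x => by
    have := hsc x p
    rw [hp, inner_zero_left] at this
    linarith
  have hH0 : ∀ x, 0 ≤ H x - H p := fun x => (by positivity : 0 ≤ μ / 2 * ‖x - p‖ ^ 2).trans (hgrow x)
  have hH1 : ∀ x, H x - H p ≤ 1 / (2 * α) * ‖x - p‖ ^ 2 := fun x => by
    have := hsm x p
    rw [hp, inner_zero_left] at this
    linarith
  have hxL : ∀ k, MemLp (x k) 2 P ∧ MemLp (b k) 2 P := by
    intro k
    induction k with
    | zero =>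
      rw [funext hx0, funext hb0]
      exact ⟨memLp_const _, memLp_const _⟩
    | succ k ih =>
      rw [hb]
      exact ⟨(integral_accelLyap_step (hℱ k) hα hμ hs0 (by linarith) hs hβ hHc hG hp hsm hsc (hxm k)
        (hbm k) ih.1 ih.2 (hw k) (hy k) (hx k) (hw0 k) hq (hwvar k)).2.1, ih.1⟩
  have hstep := fun k => integral_accelLyap_step (hℱ k) hα hμ hs0 (by linarith) hs hβ hHc hG hp hsm
    hsc (hxm k) (hbm k) (hxL k).1 (hxL k).2 (hw k) (hy k) (hx k) (hw0 k) hq (hwvar k)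
  have hVint : ∀ k, Integrable (fun ω => accelLyap H p α s (x k ω) (b k ω)) P := fun k =>
    integrable_accelLyap hHc hH0 hH1 (hxL k).1 (hxL k).2
  have hyint : ∀ k, Integrable (fun ω => ‖y k ω - p‖ ^ 2) P := fun k =>
    ((hstep k).1.sub (memLp_const p)).integrable_norm_pow two_ne_zero
  set V : ℕ → ℝ := fun k => ∫ ω, accelLyap H p α s (x k ω) (b k ω) ∂P with hVdef
  set D : ℕ → ℝ := fun k => ∫ ω, ‖y k ω - p‖ ^ 2 ∂P with hDdef
  have hD0 : ∀ k, 0 ≤ D k := fun k => integral_nonneg fun ω => by positivity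
  have hDV : ∀ k, D k ≤ 2 / μ * V k := fun k => by
    rw [hVdef, hDdef]
    simp only
    rw [← integral_const_mul]
    refine integral_mono (hyint k) ((hVint k).const_mul _) fun ω => ?_
    simp only [hy]
    exact norm_sq_extrapolation_le hμ hα hs0 hs hβ hgrow _ _
  have hrec : ∀ k, V (k + 1) ≤
      (1 - s) * V k + α * (κ + ν ^ 2 * Δ ^ 2) + α * ν ^ 2 * D k := fun k => by
    have := (hstep k).2.2
    simpa only [hVdef, hDdef, hb] using this
  have hC : 0 ≤ α * (κ + ν ^ 2 * Δ ^ 2) := by positivity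
  have hcDV : ∀ k, 2 * α * ν ^ 2 * D k ≤ s / 15 * V k := fun k => by
    have hV0 : 0 ≤ V k := by
      have := (hD0 k).trans (hDV k)
      exact (mul_nonneg_iff_of_pos_left (by positivity)).1 this
    calc 2 * α * ν ^ 2 * D k ≤ 2 * α * ν ^ 2 * (2 / μ * V k) := by gcongr; exact hDV k
      _ = (60 * α * ν ^ 2) * (V k / (15 * μ)) := by field_simp; ring
      _ ≤ (s * μ) * (V k / (15 * μ)) := by gcongr
      _ = s / 15 * V k := by field_simp
  have hV0 : ∀ k, 0 ≤ V k := fun k =>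
    (mul_nonneg_iff_of_pos_left (by positivity : 0 < 2 / μ)).1 ((hD0 k).trans (hDV k))
  have hQ : ∀ k, V k + 2 * α * ν ^ 2 * D k ≤ (1 - s / 3) ^ k * (V 0 + 2 * α * ν ^ 2 * D 0)
        + 31 / 10 * (α / s) * (κ + ν ^ 2 * Δ ^ 2) := by
    intro k
    have hCs : 31 / 10 * (α / s) * (κ + ν ^ 2 * Δ ^ 2)
        = 31 / 10 * (α * (κ + ν ^ 2 * Δ ^ 2) / s) := by ring
    have hCs' : s * (α * (κ + ν ^ 2 * Δ ^ 2) / s) = α * (κ + ν ^ 2 * Δ ^ 2) := by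
      field_simp
    rw [hCs]
    set C := α * (κ + ν ^ 2 * Δ ^ 2)
    have hCs0 : 0 ≤ C / s := by positivity
    induction k with
    | zero => simp only [pow_zero, one_mul]; linarith
    | succ k ih =>
      have h1 := hcDV (k + 1)
      have h2 := mul_le_mul_of_nonneg_left (hrec k) (by positivity : 0 ≤ 1 + s / 15)
      have h3 := mul_le_mul_of_nonneg_left ih (by linarith : 0 ≤ 1 - s / 3)
      have hE : 0 ≤ α * ν ^ 2 * D k := mul_nonneg (by positivity) (hD0 k)
      have h4 : (1 + s / 15) * ((1 - s) * V k) ≤ (1 - s / 3) * V k := by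
        nlinarith [mul_nonneg hs0.le (hV0 k), mul_nonneg (sq_nonneg s) (hV0 k)]
      have h5 : (1 + s / 15) * (α * ν ^ 2 * D k) ≤ (1 - s / 3) * (2 * α * ν ^ 2 * D k) := by
        nlinarith
      have h6 : (1 + s / 15) * C + (1 - s / 3) * (31 / 10 * (C / s)) ≤ 31 / 10 * (C / s) := by
        nlinarith
      rw [pow_succ (1 - s / 3) k]
      linarith
  have hV00 : V 0 = accelLyap H p α s x0 b0 := by simp [hVdef, hx0, hb0]
  have hD00 : D 0 = ‖((1 + β) • x0 - β • b0) - p‖ ^ 2 := by simp [hDdef, hy, hx0, hb0]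
  rw [← hV00, ← hD00]
  calc ∫ ω, ‖x k ω - p‖ ^ 2 ∂P ≤ ∫ ω, 2 / μ * accelLyap H p α s (x k ω) (b k ω) ∂P := by
        refine integral_mono (((hxL k).1.sub (memLp_const p)).integrable_norm_pow two_ne_zero)
          ((hVint k).const_mul _) fun ω => ?_
        have h1 := mul_le_mul_of_nonneg_left (hgrow (x k ω)) (by positivity : 0 ≤ 2 / μ)
        have h2 : 2 / μ * (μ / 2 * ‖x k ω - p‖ ^ 2) = ‖x k ω - p‖ ^ 2 := by field_simp
        have h3 : 0 ≤ 2 / μ * (1 / (2 * α) * ‖(x k ω - p) - (1 - s) • (b k ω - p)‖ ^ 2) := by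
          positivity
        simp only [accelLyap, mul_add]
        linarith
    _ = 2 / μ * V k := integral_const_mul _ _
    _ ≤ _ := by
        have := mul_nonneg (by positivity : 0 ≤ 2 * α * ν ^ 2) (hD0 k)
        gcongr
        linarith [hQ k]

end Stochastic

section Penalized

variable {N d : ℕ} {W : Matrix (Fin N) (Fin N) ℝ} {α : ℝ}

/-- The quadratic form of `I - 𝒲`. -/
noncomputable def mixingForm (W : Matrix (Fin N) (Fin N) ℝ)
    (x : PiLp 2 (fun _ : Fin N => EuclideanSpace ℝ (Fin d))) : ℝ :=
  (∑ i, ‖x i‖ ^ 2) - ∑ i, ∑ j, W i j * ⟪x i, x j⟫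

/-- The gradient of `penObj`. -/
noncomputable def penGrad (W : Matrix (Fin N) (Fin N) ℝ) (α : ℝ)
    (g : Fin N → EuclideanSpace ℝ (Fin d) → EuclideanSpace ℝ (Fin d))
    (x : PiLp 2 (fun _ : Fin N => EuclideanSpace ℝ (Fin d))) :
    PiLp 2 (fun _ : Fin N => EuclideanSpace ℝ (Fin d)) :=
  WithLp.toLp 2 fun i => (1 / α) • (x i - ∑ j, W i j • x j) + g i (x i)

lemma sum_mul_inner_eq_of_diagonalization {lam : Fin N → ℝ} {V : Matrix (Fin N) (Fin N) ℝ}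
    (hW : W = Vᵀ * Matrix.diagonal lam * V)
    (x : PiLp 2 (fun _ : Fin N => EuclideanSpace ℝ (Fin d))) :
    ∑ i, ∑ j, W i j * ⟪x i, x j⟫ = ∑ k, lam k * ‖∑ i, V k i • x i‖ ^ 2 := by
  have hWij : ∀ i j, W i j = ∑ k, V k i * lam k * V k j := fun i j => by
    rw [hW, Matrix.mul_apply]
    simp [Matrix.mul_diagonal]
  have hk : ∀ k, lam k * ‖∑ i, V k i • x i‖ ^ 2
      = ∑ i, ∑ j, V k i * lam k * V k j * ⟪x i, x j⟫ := fun k => by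
    rw [← real_inner_self_eq_norm_sq, sum_inner, Finset.mul_sum]
    refine Finset.sum_congr rfl fun i _ => ?_
    rw [inner_sum, Finset.mul_sum]
    refine Finset.sum_congr rfl fun j _ => ?_
    rw [real_inner_smul_left, real_inner_smul_right]
    ring
  simp_rw [hk, hWij, Finset.sum_mul]
  rw [Finset.sum_comm' (t' := Finset.univ) (s' := fun _ => Finset.univ) (by simp)]
  rw [Finset.sum_comm]
  conv_rhs => rw [Finset.sum_comm]
  exact Finset.sum_congr rfl fun i _ => Finset.sum_comm

lemma mixingForm_bounds {lam : Fin N → ℝ} {V : Matrix (Fin N) (Fin N) ℝ} (hV : V * Vᵀ = 1)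
    (hW : W = Vᵀ * Matrix.diagonal lam * V) {l : ℝ} (hl : ∀ k, l ≤ lam k) (hl1 : ∀ k, lam k ≤ 1)
    (x : PiLp 2 (fun _ : Fin N => EuclideanSpace ℝ (Fin d))) :
    0 ≤ mixingForm W x ∧ mixingForm W x ≤ (1 - l) * ‖x‖ ^ 2 := by
  have h1 : ∑ i, ‖x i‖ ^ 2 = ∑ k, ‖∑ i, V k i • x i‖ ^ 2 := by
    have h := sum_mul_inner_eq_of_diagonalization (W := 1) (lam := fun _ => 1) (V := V)
      (by rw [Matrix.diagonal_one, Matrix.mul_one, mul_eq_one_comm.1 hV]) x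
    simpa [Matrix.one_apply] using h
  rw [PiLp.norm_sq_eq_of_L2, mixingForm, sum_mul_inner_eq_of_diagonalization hW, h1,
    ← Finset.sum_sub_distrib, Finset.mul_sum]
  constructor
  · exact Finset.sum_nonneg fun k _ => by nlinarith [hl1 k, sq_nonneg ‖∑ i, V k i • x i‖]
  · exact Finset.sum_le_sum fun k _ => by nlinarith [hl k, sq_nonneg ‖∑ i, V k i • x i‖]

lemma mixingForm_expand (hW : W.IsSymm)
    (x y : PiLp 2 (fun _ : Fin N => EuclideanSpace ℝ (Fin d))) :
    mixingForm W x = mixingForm W y + 2 * ∑ i, ⟪y i - ∑ j, W i j • y j, x i - y i⟫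
      + mixingForm W (x - y) := by
  obtain ⟨z, rfl⟩ : ∃ z, x = y + z := ⟨x - y, by simp⟩
  have hsymm : ∑ i, ∑ j, W i j * ⟪z i, y j⟫ = ∑ i, ∑ j, W i j * ⟪y i, z j⟫ := by
    rw [Finset.sum_comm]
    refine Finset.sum_congr rfl fun i _ => Finset.sum_congr rfl fun j _ => ?_
    rw [hW.apply, real_inner_comm]
  have hcross : ∑ i, ⟪∑ j, W i j • y j, z i⟫ = ∑ i, ∑ j, W i j * ⟪z i, y j⟫ := by
    refine Finset.sum_congr rfl fun i _ => ?_
    rw [sum_inner]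
    refine Finset.sum_congr rfl fun j _ => ?_
    rw [real_inner_smul_left, real_inner_comm]
  simp only [mixingForm, add_sub_cancel_left, PiLp.add_apply, norm_add_sq_real, inner_add_left,
    inner_add_right, inner_sub_left, mul_add, Finset.sum_add_distrib, Finset.sum_sub_distrib,
    hcross, hsymm, ← Finset.mul_sum]
  ring

lemma penObj_expand (hW : W.IsSymm) (f : Fin N → EuclideanSpace ℝ (Fin d) → ℝ)
    (g : Fin N → EuclideanSpace ℝ (Fin d) → EuclideanSpace ℝ (Fin d))
    (x y : PiLp 2 (fun _ : Fin N => EuclideanSpace ℝ (Fin d))) :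
    penObj W α f x = penObj W α f y + ⟪penGrad W α g y, x - y⟫ + 1 / (2 * α) * mixingForm W (x - y)
      + ∑ i, (f i (x i) - f i (y i) - ⟪g i (y i), x i - y i⟫) := by
  have h := mixingForm_expand hW x y
  have h2 : ⟪penGrad W α g y, x - y⟫
      = 1 / α * (∑ i, ⟪y i - ∑ j, W i j • y j, x i - y i⟫) + ∑ i, ⟪g i (y i), x i - y i⟫ := by
    rw [PiLp.inner_apply, Finset.mul_sum, ← Finset.sum_add_distrib]
    refine Finset.sum_congr rfl fun i _ => ?_
    simp only [penGrad, PiLp.sub_apply, inner_add_left, real_inner_smul_left]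
  change 1 / (2 * α) * mixingForm W x + _ = 1 / (2 * α) * mixingForm W y + _ + _ + _ + _
  rw [h, h2]
  simp only [Finset.sum_sub_distrib]
  ring

end Penalized

/-- **Theorem (D-ASG under state-dependent gradient noise).**
Assume `L/μ ≥ 4`, `λ_N^W > 0`, `0 < α ≤ α̂` (with `α̂ = min{λ_N^W/L, μ³/(60η²)²}` if `η > 0`
and `α̂ = λ_N^W/L` if `η = 0`), `β = (1−√(αμ))/(1+√(αμ))`, suppose the noise satisfies
`E[w^{(k+1)}|ℱ_k] = 0` and `E[‖w^{(k+1)}‖²|ℱ_k] ≤ σ²N + (η²/2)‖y^{(k)} − x^*‖²`, and that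
`‖x^∞ − x^*‖ ≤ αC₁√N/(1−γ)`.  Then for every `k ≥ 0`,
`E[‖x^{(k)} − x^∞‖²] ≤ 2(1−√(αμ)/3)^k V_{Q,α}(ξ₀)/μ
  + (12√α/(μ√μ))(σ² + η²α²C₁²/(1−γ)²)N`. -/
theorem dasg_general_noise_bound
    {N d : ℕ} (hN : 0 < N) (hd : 0 < d)
    (μ L α β σ η : ℝ) (hμ : 0 < μ) (hμL : μ ≤ L) (hσ : 0 ≤ σ) (hη : 0 ≤ η)
    (hκ : 4 ≤ L / μ)
    -- the symmetric doubly stochastic mixing matrix and its eigenvalues, in decreasing order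
    (W : Matrix (Fin N) (Fin N) ℝ)
    (hWsymm : W.IsSymm)
    (hWnonneg : ∀ i j, 0 ≤ W i j)
    (hWrow : ∀ i, ∑ j, W i j = 1)
    (hWcol : ∀ j, ∑ i, W i j = 1)
    (lam : Fin N → ℝ) (V : Matrix (Fin N) (Fin N) ℝ)
    (hV : V * Vᵀ = 1)
    (hWeig : W = Vᵀ * Matrix.diagonal lam * V)
    (hlamAnti : Antitone lam)
    (hlamTop : lam ⟨0, hN⟩ = 1)
    (lamN : ℝ) (hlamN : lamN = lam ⟨N - 1, Nat.sub_lt hN Nat.one_pos⟩)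
    (hlamNpos : 0 < lamN)
    -- γ = max{|λ₂|, |λ_N|} < 1 and a constant C₁ ≥ 0
    (γ C₁ : ℝ) (hγdef : ∀ h2 : 1 < N, γ = max |lam ⟨1, h2⟩| |lamN|)
    (hγ0 : 0 ≤ γ) (hγ1 : γ < 1) (hC₁ : 0 ≤ C₁)
    -- stepsize and momentum
    (hα0 : 0 < α)
    (hαle : α ≤ if η = 0 then lamN / L else min (lamN / L) (μ ^ 3 / (60 * η ^ 2) ^ 2))
    (hβ : β = (1 - Real.sqrt (α * μ)) / (1 + Real.sqrt (α * μ)))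
    -- the local objectives: μ-strongly convex with L-Lipschitz gradients
    (f : Fin N → EuclideanSpace ℝ (Fin d) → ℝ)
    (gradf : Fin N → EuclideanSpace ℝ (Fin d) → EuclideanSpace ℝ (Fin d))
    (hgrad : ∀ i x, HasGradientAt (f i) (gradf i x) x)
    (hlip : ∀ i, LipschitzWith (Real.toNNReal L) (gradf i))
    (hconv : ∀ i, ConvexOn ℝ Set.univ (fun x => f i x - μ / 2 * ‖x‖ ^ 2))
    -- the minimizer x_* of f = (1/N)∑ f_i, and x^* = (x_*,…,x_*)
    (xstar : EuclideanSpace ℝ (Fin d))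
    (hxstar : ∀ y, (1 / (N : ℝ)) * ∑ i, f i xstar ≤ (1 / (N : ℝ)) * ∑ i, f i y)
    (xstarN : PiLp 2 (fun _ : Fin N => EuclideanSpace ℝ (Fin d)))
    (hxstarN : ∀ i, xstarN i = xstar)
    -- the fixed point x^∞ : solution of (I − 𝒲)x + α ∇F(x) = 0, and its distance to x^*
    (xinf : PiLp 2 (fun _ : Fin N => EuclideanSpace ℝ (Fin d)))
    (hxinf : ∀ i, (xinf i - ∑ j, W i j • xinf j) + α • gradf i (xinf i) = 0)
    (hxinfstar : ‖xinf - xstarN‖ ≤ α * C₁ * Real.sqrt N / (1 - γ))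
    -- probability space, filtration and the D-ASG iterates
    {Ω : Type} {mΩ : MeasurableSpace Ω} (P : Measure Ω) [IsProbabilityMeasure P]
    (ℱ : ℕ → MeasurableSpace Ω) (hℱ : ∀ k, ℱ k ≤ mΩ) (hℱmono : Monotone ℱ)
    (X Y w : ℕ → Ω → PiLp 2 (fun _ : Fin N => EuclideanSpace ℝ (Fin d)))
    (x0 xm1 : PiLp 2 (fun _ : Fin N => EuclideanSpace ℝ (Fin d)))
    (hX0 : ∀ ω, X 0 ω = x0)
    (hY0 : ∀ ω i, Y 0 ω i = (1 + β) • x0 i - β • xm1 i)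
    (hYS : ∀ k ω i, Y (k + 1) ω i = (1 + β) • X (k + 1) ω i - β • X k ω i)
    (hXadapted : ∀ k, StronglyMeasurable[ℱ k] (X k))
    (hwmeas : ∀ k, StronglyMeasurable[ℱ (k + 1)] (w (k + 1)))
    (hrec : ∀ k ω i, X (k + 1) ω i =
      (∑ j, W i j • Y k ω j) - α • gradf i (Y k ω i) - α • w (k + 1) ω i)
    -- the gradient noise: conditionally centered, with state-dependent conditional variance
    (hwmean : ∀ k, P[w (k + 1)|ℱ k] =ᵐ[P] 0)
    (hwL2 : ∀ k, Integrable (fun ω => ‖w (k + 1) ω‖ ^ 2) P)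
    (hwvar : ∀ k, ∀ᵐ ω ∂P, (P[fun ω' => ‖w (k + 1) ω'‖ ^ 2|ℱ k]) ω ≤
      σ ^ 2 * N + η ^ 2 / 2 * ‖Y k ω - xstarN‖ ^ 2) :
    ∀ k : ℕ,
      ∫ ω, ‖X k ω - xinf‖ ^ 2 ∂P ≤
        2 * (1 - Real.sqrt (α * μ) / 3) ^ k *
            (lyapQ W α μ β η f xinf (x0 - xinf) (xm1 - xinf) / μ) +
          12 * Real.sqrt α / (μ * Real.sqrt μ) *
            (σ ^ 2 + η ^ 2 * α ^ 2 * C₁ ^ 2 / (1 - γ) ^ 2) * N := by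
  have hL : 0 < L := hμ.trans_le hμL
  have hlam1 : ∀ k, lam k ≤ 1 := fun k => hlamTop ▸ hlamAnti (Fin.mk_le_of_le_val (Nat.zero_le _))
  have hlamN' : ∀ k, lamN ≤ lam k := fun k => by
    rw [hlamN]
    exact hlamAnti (Fin.le_def.2 (Nat.le_sub_one_of_lt k.2))
  have hαL : α * L ≤ lamN := by
    rw [← le_div_iff₀ hL]
    split_ifs at hαle
    · exact hαle
    · exact hαle.trans (min_le_left _ _)
  have hlamN1 : lamN ≤ 1 := (hlamN' ⟨0, hN⟩).trans (hlam1 _)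
  have hαμ : α * μ ≤ 1 / 4 := by
    rw [le_div_iff₀ hμ] at hκ
    nlinarith
  set s := Real.sqrt (α * μ) with hs_def
  have hs0 : 0 < s := Real.sqrt_pos.2 (by positivity)
  have hs2 : s ^ 2 = α * μ := Real.sq_sqrt (by positivity)
  have hs_half : s ≤ 1 / 2 := by nlinarith
  have hη60 : 60 * α * η ^ 2 ≤ s * μ := by
    split_ifs at hαle with h0
    · rw [h0]
      have : 0 ≤ s * μ := by positivity
      simpa using this
    · have h1 : α * (60 * η ^ 2) ^ 2 ≤ μ ^ 3 :=
        (le_div_iff₀ (by positivity)).1 (hαle.trans (min_le_right _ _))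
      refine le_of_sq_le_sq ?_ (by positivity)
      rw [mul_pow s, hs2]
      nlinarith [mul_le_mul_of_nonneg_left h1 hα0.le]
  have hfi : ∀ i, Continuous (f i) := fun i =>
    continuous_iff_continuousAt.2 fun x => (hgrad i x).continuousAt
  have hHc : Continuous (penObj W α f) := by
    unfold penObj
    fun_prop
  have hGc : Continuous (penGrad W α gradf) := by
    have hgi : ∀ i, Continuous (gradf i) := fun i => (hlip i).continuous
    unfold penGrad
    fun_prop
  have hGp : penGrad W α gradf xinf = 0 := by
    ext1 i
    have h : α • (penGrad W α gradf xinf i) = 0 := by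
      rw [← hxinf i]
      simp only [penGrad, smul_add, smul_smul]
      rw [mul_one_div_cancel hα0.ne', one_smul]
    exact (smul_eq_zero.1 h).resolve_left hα0.ne'
  have hsm : ∀ x y, penObj W α f x ≤ penObj W α f y + ⟪penGrad W α gradf y, x - y⟫
      + 1 / (2 * α) * ‖x - y‖ ^ 2 := fun x y => by
    rw [penObj_expand hWsymm f gradf x y]
    have h1 := (mixingForm_bounds hV hWeig hlamN' hlam1 (x - y)).2
    have h2 : ∑ i, (f i (x i) - f i (y i) - ⟪gradf i (y i), x i - y i⟫)
        ≤ L / 2 * ‖x - y‖ ^ 2 := by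
      rw [PiLp.norm_sq_eq_of_L2, Finset.mul_sum]
      refine Finset.sum_le_sum fun i _ => ?_
      have := le_add_inner_gradient_of_lipschitz (hgrad i) (L := L) (fun a b => by
        simpa [dist_eq_norm, Real.coe_toNNReal L hL.le] using (hlip i).dist_le_mul a b) (x i) (y i)
      rw [PiLp.sub_apply]
      linarith
    have h3 : 1 / (2 * α) * mixingForm W (x - y) ≤ 1 / (2 * α) * ((1 - lamN) * ‖x - y‖ ^ 2) := by
      gcongr
    have h4 : 1 / (2 * α) * ((1 - lamN) * ‖x - y‖ ^ 2) + L / 2 * ‖x - y‖ ^ 2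
        = 1 / (2 * α) * ((1 - lamN + α * L) * ‖x - y‖ ^ 2) := by
      field_simp
    have h5 : 1 / (2 * α) * ((1 - lamN + α * L) * ‖x - y‖ ^ 2)
        ≤ 1 / (2 * α) * (1 * ‖x - y‖ ^ 2) := by
      gcongr
      linarith
    linarith
  have hsc : ∀ x y, penObj W α f y + ⟪penGrad W α gradf y, x - y⟫ + μ / 2 * ‖x - y‖ ^ 2
      ≤ penObj W α f x := fun x y => by
    rw [penObj_expand hWsymm f gradf x y]
    have h1 := (mixingForm_bounds hV hWeig hlamN' hlam1 (x - y)).1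
    have h2 : μ / 2 * ‖x - y‖ ^ 2
        ≤ ∑ i, (f i (x i) - f i (y i) - ⟪gradf i (y i), x i - y i⟫) := by
      rw [PiLp.norm_sq_eq_of_L2, Finset.mul_sum]
      refine Finset.sum_le_sum fun i _ => ?_
      have := add_inner_gradient_le_of_strongConvex (hgrad i) (hconv i) (x i) (y i)
      rw [PiLp.sub_apply]
      linarith
    have h3 : 0 ≤ 1 / (2 * α) * mixingForm W (x - y) := by positivity
    linarith
  set b : ℕ → Ω → PiLp 2 (fun _ : Fin N => EuclideanSpace ℝ (Fin d)) :=
    fun k => Nat.casesOn k (fun _ => xm1) X with hb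
  have hbm : ∀ k, StronglyMeasurable[ℱ k] (b k) := fun k => by
    cases k with
    | zero => exact stronglyMeasurable_const
    | succ k => exact (hXadapted k).mono (hℱmono k.le_succ)
  have hwL : ∀ k, MemLp (w (k + 1)) 2 P := fun k =>
    (memLp_two_iff_integrable_sq_norm
      ((hwmeas k).mono (hℱ (k + 1))).aestronglyMeasurable).2 (hwL2 k)
  have hY : ∀ k ω, Y k ω = (1 + β) • X k ω - β • b k ω := fun k ω => by
    ext1 i
    cases k with
    | zero => rw [hY0, hX0]; rfl
    | succ k => rw [hYS]; rfl
  have hX : ∀ k ω, X (k + 1) ω = Y k ω - α • penGrad W α gradf (Y k ω) - α • w (k + 1) ω :=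
    fun k ω => by
      ext1 i
      rw [hrec]
      simp only [PiLp.sub_apply, PiLp.smul_apply, penGrad, smul_add, smul_smul]
      rw [mul_one_div_cancel hα0.ne', one_smul]
      abel
  intro k
  have hmain := integral_accelLyap_le hα0 hμ hs0 hs_half hs2 hβ hHc hGc hGp hsm hsc hℱ hX0
    (fun _ => rfl : ∀ ω, b 0 ω = xm1) (fun _ => rfl) hXadapted hbm hwL hY hX hwmean
    (by positivity : 0 ≤ σ ^ 2 * (N : ℝ)) hxinfstar hη60 hwvar k
  have hlyap : accelLyap (penObj W α f) xinf α s x0 xm1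
      + 2 * α * η ^ 2 * ‖((1 + β) • x0 - β • xm1) - xinf‖ ^ 2
      = lyapQ W α μ β η f xinf (x0 - xinf) (xm1 - xinf) := by
    have h1 : Real.sqrt (μ / 2) = s * Real.sqrt (1 / (2 * α)) := by
      rw [hs_def, ← Real.sqrt_mul (by positivity)]
      congr 1
      field_simp
    have h2 : Real.sqrt (1 / (2 * α)) • (x0 - xinf)
        + (Real.sqrt (μ / 2) - Real.sqrt (1 / (2 * α))) • (xm1 - xinf)
        = Real.sqrt (1 / (2 * α)) • ((x0 - xinf) - (1 - s) • (xm1 - xinf)) := by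
      rw [h1]
      module
    have h3 : (1 + β) • (x0 - xinf) - β • (xm1 - xinf) = ((1 + β) • x0 - β • xm1) - xinf := by
      module
    rw [lyapQ, accelLyap, h2, h3, norm_smul, mul_pow, Real.norm_eq_abs, sq_abs,
      Real.sq_sqrt (by positivity), sub_add_cancel]
    ring
  rw [hlyap] at hmain
  refine hmain.trans ?_
  have hγ' : 0 < 1 - γ := by linarith
  have hK : σ ^ 2 * N + η ^ 2 * (α * C₁ * Real.sqrt N / (1 - γ)) ^ 2
      = (σ ^ 2 + η ^ 2 * α ^ 2 * C₁ ^ 2 / (1 - γ) ^ 2) * N := by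
    rw [div_pow, mul_pow, Real.sq_sqrt (Nat.cast_nonneg N)]
    ring
  have hαs : α / s = Real.sqrt α / Real.sqrt μ := by
    rw [hs_def, Real.sqrt_mul hα0.le, div_eq_div_iff (by positivity) (by positivity)]
    nth_rw 1 [← Real.mul_self_sqrt hα0.le]
    ring
  rw [hK, hαs]
  have hR : 0 ≤ Real.sqrt α / (μ * Real.sqrt μ)
      * ((σ ^ 2 + η ^ 2 * α ^ 2 * C₁ ^ 2 / (1 - γ) ^ 2) * N) := by
    positivity
  have hsplit : 2 / μ * (31 / 10 * (Real.sqrt α / Real.sqrt μ)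
      * ((σ ^ 2 + η ^ 2 * α ^ 2 * C₁ ^ 2 / (1 - γ) ^ 2) * N))
      = 31 / 5 * (Real.sqrt α / (μ * Real.sqrt μ)
      * ((σ ^ 2 + η ^ 2 * α ^ 2 * C₁ ^ 2 / (1 - γ) ^ 2) * N)) := by
    field_simp
    ring
  rw [mul_add, hsplit]
  have e1 : 2 / μ * ((1 - s / 3) ^ k * lyapQ W α μ β η f xinf (x0 - xinf) (xm1 - xinf))
      = 2 * (1 - s / 3) ^ k * (lyapQ W α μ β η f xinf (x0 - xinf) (xm1 - xinf) / μ) := by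
    ring
  have e2 : 12 * Real.sqrt α / (μ * Real.sqrt μ)
      * (σ ^ 2 + η ^ 2 * α ^ 2 * C₁ ^ 2 / (1 - γ) ^ 2) * N
      = 12 * (Real.sqrt α / (μ * Real.sqrt μ)
      * ((σ ^ 2 + η ^ 2 * α ^ 2 * C₁ ^ 2 / (1 - γ) ^ 2) * N)) := by
    ring
  rw [e1, e2]
  linarith
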